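/- arXiv:2507.05028 — 8 statements merged into one kernel-verified Lean document; each statement's English description precedes it below -/
import Mathlib

section
/- ℕ has the strong Myhill property: for any injective functions f g : ℕ → ℕ there exists a bijection h : ℕ → ℕ such that for every n : ℕ, either there exists k : ℕ with h n = f ((g ∘ f)^[k] n), or there exists k : ℕ with n = (g ∘ f)^[k] (g (h n)). -/
/-- ℕ has the strong Myhill property. -/
theorem nat_strong_myhill (f g : ℕ → ℕ) (hf : Function.Injective f)
    (hg : Function.Injective g) :
    ∃ h : ℕ → ℕ, Function.Bijective h ∧
      ∀ n : ℕ, (∃ k : ℕ, h n = f ((g ∘ f)^[k] n)) ∨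
        (∃ k : ℕ, n = (g ∘ f)^[k] (g (h n))) := by
  -- The Schröder–Bernstein bijection only uses edges `a ↦ f a` and `g b ↦ b`, so `k = 0` suffices.
  exact Function.Embedding.schroeder_bernstein_of_rel hf hg
    (fun a b => (∃ k : ℕ, b = f ((g ∘ f)^[k] a)) ∨ (∃ k : ℕ, a = (g ∘ f)^[k] (g b)))
    (fun _ => Or.inl ⟨0, rfl⟩) (fun _ => Or.inr ⟨0, rfl⟩)
end

section
/- Myhill isomorphism theorem: for any sets A B : Set ℕ and injective functions f g : ℕ → ℕ with A = f ⁻¹' B and B = g ⁻¹' A, there exists a bijection h : ℕ → ℕ such that h '' A = B (so h restricts to a bijection between A and B). -/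
/-- Myhill isomorphism theorem for ℕ. -/
theorem myhill_isomorphism (A B : Set ℕ) (f g : ℕ → ℕ)
    (hf : Function.Injective f) (hg : Function.Injective g)
    (hA : A = f ⁻¹' B) (hB : B = g ⁻¹' A) :
    ∃ h : ℕ → ℕ, Function.Bijective h ∧ h '' A = B := by
  obtain ⟨h, hh, hrel⟩ := Function.Embedding.schroeder_bernstein_of_rel hf hg
    (fun x y ↦ x ∈ A ↔ y ∈ B) (fun x ↦ by rw [hA, Set.mem_preimage])
    (fun y ↦ by rw [hB, Set.mem_preimage])
  refine ⟨h, hh, ?_⟩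
  have hpre : A = h ⁻¹' B := Set.ext hrel
  rw [hpre, Set.image_preimage_eq B hh.surjective]
end

section
/- Let X be a type, f g : X → X functions, and A B : Set X subsets with A = f ⁻¹' B and B = g ⁻¹' A. If h : X → X is a bijection such that for every x : X, either there exists k : ℕ with h x = f ((g ∘ f)^[k] x), or there exists k : ℕ with x = (g ∘ f)^[k] (g (h x)), then h '' A = B. (Thus the strong Myhill property implies the Myhill property.) -/
/-- Iterating `φ` preserves and reflects membership in a set that is its own preimage
under `φ`. -/
theorem iterate_mem_iff_of_preimage_eq {X : Type*} {φ : X → X} {A : Set X}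
    (hφ : φ ⁻¹' A = A) (k : ℕ) (x : X) : φ^[k] x ∈ A ↔ x ∈ A := by
  rw [← Set.mem_preimage, Set.preimage_iterate_eq, Function.iterate_fixed hφ]


/-- The strong Myhill property implies the Myhill property: a bijection
generated by `(f, g)` maps `A` onto `B` whenever `f` reduces `A` to `B`
and `g` reduces `B` to `A`. -/
theorem generated_bijection_maps_reduction {X : Type*} (f g : X → X)
    (A B : Set X) (hA : A = f ⁻¹' B) (hB : B = g ⁻¹' A)
    (h : X → X) (hbij : Function.Bijective h)
    (hgen : ∀ x : X, (∃ k : ℕ, h x = f ((g ∘ f)^[k] x)) ∨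
      (∃ k : ℕ, x = (g ∘ f)^[k] (g (h x)))) :
    h '' A = B := by
  have mem_f : ∀ x, f x ∈ B ↔ x ∈ A := fun x => (Set.ext_iff.mp hA x).symm
  have mem_g : ∀ y, g y ∈ A ↔ y ∈ B := fun y => (Set.ext_iff.mp hB y).symm
  have mem_iterate := iterate_mem_iff_of_preimage_eq (φ := g ∘ f) (A := A)
    (Set.ext fun x => (mem_g (f x)).trans (mem_f x))
  have mem_h : h ⁻¹' B = A := by
    ext x
    obtain ⟨k, hk⟩ | ⟨k, hk⟩ := hgen x
    · rw [Set.mem_preimage, hk, mem_f, mem_iterate]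
    · rw [Set.mem_preimage, ← mem_g, ← mem_iterate k, ← hk]
  rw [← mem_h, Set.image_preimage_eq B hbij.surjective]
end

section
/- ℕ∞ is a final coalgebra for the functor X ↦ 1 + X: for every type X and every function c : X → Option X, there exists a unique function f : X → ℕ∞ such that for all x : X, if c x = none then f x = 0, and for all x' : X, if c x = some x' then f x = f x' + 1. -/
namespace ENatCoalgebra

/-- The number of steps `c` makes from a given state before reaching `none`, truncated at `n`. -/
def truncatedSteps {X : Type*} (c : X → Option X) : ℕ → X → ℕ∞
  | 0, _ => 0
  | n + 1, x => (c x).elim 0 fun y => truncatedSteps c n y + 1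

/-- The number of steps `c` makes from a given state before reaching `none`. -/
noncomputable def steps {X : Type*} (c : X → Option X) (x : X) : ℕ∞ :=
  ⨆ n, truncatedSteps c n x

theorem steps_eq_iSup_succ {X : Type*} (c : X → Option X) (x : X) :
    steps c x = ⨆ n, truncatedSteps c (n + 1) x := by
  rw [steps, ← sup_iSup_nat_succ]
  simp [truncatedSteps]

theorem steps_of_eq_none {X : Type*} {c : X → Option X} {x : X} (h : c x = none) :
    steps c x = 0 := by
  simp [steps_eq_iSup_succ, truncatedSteps, h]

theorem steps_of_eq_some {X : Type*} {c : X → Option X} {x y : X} (h : c x = some y) :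
    steps c x = steps c y + 1 := by
  rw [steps_eq_iSup_succ, steps, ENat.iSup_add]
  simp [truncatedSteps, h]

/-- Any two coalgebra morphisms into `ℕ∞` have the same finite lower bounds. -/
theorem natCast_le_of_natCast_le {X : Type*} {c : X → Option X} {f g : X → ℕ∞}
    (hf : ∀ x, (c x = none → f x = 0) ∧ ∀ y, c x = some y → f x = f y + 1)
    (hg : ∀ x, (c x = none → g x = 0) ∧ ∀ y, c x = some y → g x = g y + 1)
    (n : ℕ) (x : X) (h : (n : ℕ∞) ≤ f x) : (n : ℕ∞) ≤ g x := by
  induction n generalizing x with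
  | zero => simp
  | succ n ih =>
    cases hx : c x with
    | none => simp [(hf x).1 hx] at h
    | some y =>
      rw [(hf x).2 y hx, Nat.cast_succ, ENat.add_le_add_iff_right ENat.one_ne_top] at h
      rw [(hg x).2 y hx, Nat.cast_succ]
      gcongr
      exact ih y h

end ENatCoalgebra


/-- ℕ∞ is a final coalgebra for the functor `X ↦ 1 + X` (realized as `Option`). -/
theorem enat_final_coalgebra {X : Type*} (c : X → Option X) :
    ∃! f : X → ℕ∞, ∀ x : X,
      (c x = none → f x = 0) ∧ (∀ x' : X, c x = some x' → f x = f x' + 1) := by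
  have hsteps : ∀ x, (c x = none → ENatCoalgebra.steps c x = 0) ∧
      ∀ y, c x = some y → ENatCoalgebra.steps c x = ENatCoalgebra.steps c y + 1 :=
    fun _ => ⟨ENatCoalgebra.steps_of_eq_none, fun _ => ENatCoalgebra.steps_of_eq_some⟩
  refine ⟨ENatCoalgebra.steps c, hsteps, fun g hg => funext fun x => ?_⟩
  exact ENat.eq_of_forall_natCast_le_iff fun n =>
    ⟨ENatCoalgebra.natCast_le_of_natCast_le hg hsteps n x,
      ENatCoalgebra.natCast_le_of_natCast_le hsteps hg n x⟩
end

section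
/- Characterization of continuous injections of 2 × ℕ∞: let f : Bool × ℕ∞ → Bool × ℕ∞ be injective. Then f is continuous if and only if there exist j : Bool, n : ℕ, and a continuous function f' : Bool × ℕ∞ → ℕ∞ such that for every i : Bool and every x : ℕ∞, f (i, ↑n + x) = (xor i j, f' (i, x)). -/
open Filter Topology in
/-- The neighbourhoods of `⊤` in `ℕ∞` are the sets containing a final segment. -/
theorem ENat.eventually_nhds_top_iff {p : ℕ∞ → Prop} :
    (∀ᶠ x in 𝓝 ⊤, p x) ↔ ∃ n : ℕ, ∀ x : ℕ∞, p (n + x) := by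
  constructor
  · intro h
    obtain ⟨a, ha, hp⟩ := nhds_top_basis.mem_iff.1 h
    lift a to ℕ using ha.ne
    refine ⟨a + 1, fun x ↦ hp ?_⟩
    calc (a : ℕ∞) < (a + 1 : ℕ) := by exact_mod_cast a.lt_succ_self
      _ ≤ (a + 1 : ℕ) + x := le_self_add
  · rintro ⟨n, hn⟩
    filter_upwards [le_mem_nhds (ENat.natCast_lt_top n)] with x hx
    simpa [add_tsub_cancel_of_le hx] using hn (x - n)

open Filter Topology in
/-- An injective map out of `ℕ∞` sends `⊤` to a non-isolated point if it is continuous there. -/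
theorem ENat.nhds_ne_pure_of_continuousAt_top {X : Type*} [TopologicalSpace X] {g : ℕ∞ → X}
    (hg : Function.Injective g) (hc : ContinuousAt g ⊤) : 𝓝 (g ⊤) ≠ pure (g ⊤) := by
  intro h
  rw [ContinuousAt, h, tendsto_pure] at hc
  obtain ⟨n, hn⟩ := ENat.eventually_nhds_top_iff.1 hc
  simpa using hg (hn 0)

open Topology in
/-- Continuous injections of `Bool × ℕ∞` preserve the points at infinity. -/
theorem snd_apply_top_of_injective {f : Bool × ℕ∞ → Bool × ℕ∞} (hf : Function.Injective f)
    (hc : Continuous f) (i : Bool) : (f (i, ⊤)).2 = ⊤ := by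
  by_contra h
  refine ENat.nhds_ne_pure_of_continuousAt_top (g := fun x ↦ f (i, x))
    (hf.comp (Prod.mk_right_injective i)) (by fun_prop) ?_
  rw [nhds_prod_eq, ENat.nhds_eq_pure h, nhds_discrete, Filter.prod_pure_pure]

/-- Characterization of continuous injections of `Bool × ℕ∞`. -/
theorem continuous_injection_bool_enat_iff (f : Bool × ℕ∞ → Bool × ℕ∞)
    (hf : Function.Injective f) :
    Continuous f ↔
      ∃ (j : Bool) (n : ℕ) (f' : Bool × ℕ∞ → ℕ∞), Continuous f' ∧
        ∀ (i : Bool) (x : ℕ∞), f (i, (n : ℕ∞) + x) = (Bool.xor i j, f' (i, x)) := by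
  constructor
  · intro hc
    have hne : (f (true, ⊤)).1 ≠ (f (false, ⊤)).1 := fun h ↦ by
      simpa using hf (Prod.ext h ((snd_apply_top_of_injective hf hc true).trans
        (snd_apply_top_of_injective hf hc false).symm))
    have hxor (i : Bool) : (f (i, ⊤)).1 = Bool.xor i (f (false, ⊤)).1 := by
      cases i
      · simp
      · simpa using Bool.eq_not.2 hne
    have hev : ∀ᶠ x in nhds (⊤ : ℕ∞), ∀ i, (f (i, x)).1 = (f (i, ⊤)).1 := by
      refine Filter.eventually_all.2 fun i ↦ ?_
      have h : Continuous fun x : ℕ∞ ↦ (f (i, x)).1 := by fun_prop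
      simpa [ContinuousAt] using h.continuousAt (x := ⊤)
    obtain ⟨n, hn⟩ := ENat.eventually_nhds_top_iff.1 hev
    exact ⟨(f (false, ⊤)).1, n, fun p ↦ (f (p.1, n + p.2)).2, by fun_prop,
      fun i x ↦ Prod.ext ((hn x i).trans (hxor i)) rfl⟩
  · rintro ⟨j, n, f', hf', h⟩
    refine continuous_prod_of_discrete_left.2 fun i ↦ continuous_iff_continuousAt.2 fun x ↦ ?_
    obtain rfl | hx := eq_or_ne x ⊤
    · have hsub : Continuous fun x : ℕ∞ ↦ x - n :=
        continuous_id.enatSub continuous_const fun _ ↦ .inr (ENat.natCast_ne_top n)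
      have hg : Continuous fun x : ℕ∞ ↦ (Bool.xor i j, f' (i, x - n)) := by fun_prop
      refine hg.continuousAt.congr ?_
      filter_upwards [le_mem_nhds (ENat.natCast_lt_top n)] with x hx
      rw [← h, add_tsub_cancel_of_le hx]
    · simp [ContinuousAt, ENat.nhds_eq_pure hx, tendsto_pure_nhds]
end

section
/- For any two continuous injective functions f g : Bool × ℕ∞ → Bool × ℕ∞, there exists a continuous bijection h : Bool × ℕ∞ → Bool × ℕ∞ such that for every z : Bool × ℕ∞, either there exists k : ℕ with h z = f ((g ∘ f)^[k] z), or there exists k : ℕ with z = (g ∘ f)^[k] (g (h z)). -/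
open Filter Topology

theorem ENat.not_isOpen_singleton_top : ¬ IsOpen ({⊤} : Set ℕ∞) := fun h ↦ by
  obtain ⟨n, hn⟩ := (ENat.tendsto_natCast_nhds_top.eventually (h.mem_nhds rfl)).exists
  exact ENat.natCast_ne_top n hn

theorem isOpen_singleton_prod_enat_iff {α : Type*} [TopologicalSpace α] [DiscreteTopology α]
    {z : α × ℕ∞} : IsOpen {z} ↔ z.2 ≠ ⊤ := by
  obtain ⟨a, n⟩ := z
  refine ⟨?_, fun h ↦ ?_⟩
  · rintro h (rfl : n = ⊤)
    refine ENat.not_isOpen_singleton_top ?_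
    convert h.preimage (Continuous.prodMk_right a)
    ext m
    simp
  · rw [← Set.singleton_prod_singleton]
    exact (isOpen_discrete {a}).prod (ENat.isOpen_singleton h)

/-- A continuous injection maps limit points to limit points. -/
theorem Continuous.snd_eq_top_of_injective {α : Type*} [TopologicalSpace α] [DiscreteTopology α]
    {f : α × ℕ∞ → α × ℕ∞} (hfc : Continuous f) (hf : Function.Injective f)
    {z : α × ℕ∞} (hz : z.2 = ⊤) : (f z).2 = ⊤ := by
  by_contra h
  have := (isOpen_singleton_prod_enat_iff.2 h).preimage hfc
  rw [← Set.image_singleton, hf.preimage_image] at this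
  exact isOpen_singleton_prod_enat_iff.1 this hz

/-- A map that is pointwise a value of `f` or a preimage under `φ` is continuous wherever
`φ` is a left inverse of `f`. -/
theorem continuousAt_of_eq_or_eq {X Y : Type*} [TopologicalSpace X] [T2Space X]
    [TopologicalSpace Y] [CompactSpace Y] {f h : X → Y} {φ : Y → X} {x : X}
    (hf : ContinuousAt f x) (hφc : Continuous φ) (hφ : Function.Injective φ)
    (hx : φ (f x) = x) (hh : ∀ z, h z = f z ∨ z = φ (h z)) : ContinuousAt h x := by
  have hfx : h x = f x := (hh x).elim id fun e ↦ hφ (e.symm.trans hx.symm)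
  rw [ContinuousAt, hfx]
  refine tendsto_nhds.2 fun U hU hxU ↦ ?_
  have hclosed : IsClosed (φ '' Uᶜ) := (hU.isClosed_compl.isCompact.image hφc).isClosed
  have hnot : x ∉ φ '' Uᶜ := by
    rintro ⟨y, hy, hyx⟩
    exact hy (hφ (hyx.trans hx.symm) ▸ hxU)
  filter_upwards [hf.eventually (hU.mem_nhds hxU), hclosed.isOpen_compl.mem_nhds hnot]
    with z hz hz'
  rcases hh z with e | e
  · rwa [Set.mem_preimage, e]
  · by_contra hc
    exact hz' ⟨h z, hc, e.symm⟩

/-- A continuous injection of `Bool × ℕ∞` is an involution on limit points. -/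
theorem Continuous.apply_apply_of_snd_eq_top {p : Bool × ℕ∞ → Bool × ℕ∞} (hpc : Continuous p)
    (hp : Function.Injective p) {z : Bool × ℕ∞} (hz : z.2 = ⊤) : p (p z) = z := by
  have h₁ := hpc.snd_eq_top_of_injective hp hz
  have h₂ := hpc.snd_eq_top_of_injective hp h₁
  by_cases h : p z = z
  · rw [h, h]
  have h' : p (p z) ≠ p z := hp.ne h
  simp only [ne_eq, Prod.ext_iff, h₁, h₂, hz, and_true] at h h' ⊢
  exact (Bool.eq_not_of_ne h').trans (by simp [Bool.eq_not_of_ne h])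

/-- For any two continuous injections of `Bool × ℕ∞` there is a continuous
bijection generated by them. -/
theorem continuous_strong_myhill_bool_enat
    (f g : Bool × ℕ∞ → Bool × ℕ∞)
    (hfc : Continuous f) (hgc : Continuous g)
    (hf : Function.Injective f) (hg : Function.Injective g) :
    ∃ h : Bool × ℕ∞ → Bool × ℕ∞, Continuous h ∧ Function.Bijective h ∧
      ∀ z : Bool × ℕ∞, (∃ k : ℕ, h z = f ((g ∘ f)^[k] z)) ∨
        (∃ k : ℕ, z = (g ∘ f)^[k] (g (h z))) := by
  have hφ : Function.Injective (g ∘ f ∘ g) := hg.comp (hf.comp hg)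
  obtain ⟨h, hbij, hh⟩ := Function.Embedding.schroeder_bernstein_of_rel hf hφ
    (fun x y ↦ y = f x ∨ x = (g ∘ f ∘ g) y) (fun _ ↦ .inl rfl) (fun _ ↦ .inr rfl)
  refine ⟨h, continuous_iff_continuousAt.2 fun z ↦ ?_, hbij, fun z ↦ ?_⟩
  · by_cases hz : z.2 = ⊤
    · exact continuousAt_of_eq_or_eq hfc.continuousAt (hgc.comp (hfc.comp hgc)) hφ
        ((hgc.comp hfc).apply_apply_of_snd_eq_top (hg.comp hf) hz) hh
    · rw [ContinuousAt, (isOpen_singleton_iff_nhds_eq_pure z).1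
        (isOpen_singleton_prod_enat_iff.2 hz)]
      exact tendsto_pure_nhds h z
  · exact (hh z).imp (fun e ↦ ⟨0, e⟩) (fun e ↦ ⟨1, e⟩)
end

section
/- Extension lemma for Baire space: let S : Set (ℕ → ℕ) be the set of sequences x such that x k ≤ 1 for all k ≥ 1 and there is at most one k ≥ 1 with x k = 1 (the copy of ℕ × ℕ∞ inside Baire space). Let f : S → S be an injective function admitting a modulus of continuity μ : ℕ → ℕ → ℕ, meaning: for all x y : S and n : ℕ, if x and y agree on all indices k < μ (x 0) n, then the n-th values of f x and f y agree. Then there exists a continuous injective function F : (ℕ → ℕ) → (ℕ → ℕ) such that F agrees with f on S and F ⁻¹' S = S (i.e. for every z, F z ∈ S if and only if z ∈ S). -/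
/-- The copy of `ℕ × ℕ∞` inside Baire space: sequences whose values at
positive indices are at most `1`, with at most one positive index equal to `1`. -/
def NNinfty : Set (ℕ → ℕ) :=
  {x | (∀ k : ℕ, 1 ≤ k → x k ≤ 1) ∧
    ∀ k k' : ℕ, 1 ≤ k → 1 ≤ k' → x k = 1 → x k' = 1 → k = k'}

/-- The values of `z` at indices up to `n` violate neither condition defining `NNinfty`. -/
def NNinftyUpTo (z : ℕ → ℕ) (n : ℕ) : Prop :=
  (∀ k ≤ n, 1 ≤ k → z k ≤ 1) ∧
    ∀ k ≤ n, ∀ k' ≤ n, 1 ≤ k → 1 ≤ k' → z k = 1 → z k' = 1 → k = k'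

lemma NNinftyUpTo.zero (z : ℕ → ℕ) : NNinftyUpTo z 0 :=
  ⟨by intros; omega, by intros; omega⟩

lemma NNinftyUpTo.mono {z : ℕ → ℕ} {m n : ℕ} (hmn : m ≤ n) (h : NNinftyUpTo z n) :
    NNinftyUpTo z m :=
  ⟨fun k hk => h.1 k (hk.trans hmn),
    fun k hk k' hk' => h.2 k (hk.trans hmn) k' (hk'.trans hmn)⟩

lemma NNinftyUpTo.congr {z w : ℕ → ℕ} {n : ℕ} (h : ∀ k ≤ n, z k = w k)
    (hz : NNinftyUpTo z n) : NNinftyUpTo w n :=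
  ⟨fun k hk => h k hk ▸ hz.1 k hk,
    fun k hk k' hk' => h k hk ▸ h k' hk' ▸ hz.2 k hk k' hk'⟩

lemma mem_NNinfty_iff_forall_upTo {z : ℕ → ℕ} : z ∈ NNinfty ↔ ∀ n, NNinftyUpTo z n :=
  ⟨fun h _ => ⟨fun k _ => h.1 k, fun k _ k' _ => h.2 k k'⟩,
    fun h => ⟨fun k => (h k).1 k le_rfl, fun k k' =>
      (h (max k k')).2 k (le_max_left k k') k' (le_max_right k k')⟩⟩

open Classical in
/-- Replace the values of `z` by `0` from the first violation of the conditions defining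
`NNinfty` onwards. -/
noncomputable def truncNNinfty (z : ℕ → ℕ) (n : ℕ) : ℕ :=
  if NNinftyUpTo z n then z n else 0

lemma truncNNinfty_mem (z : ℕ → ℕ) : truncNNinfty z ∈ NNinfty := by
  refine ⟨fun k hk => ?_, fun k k' hk hk' h h' => ?_⟩
  · unfold truncNNinfty
    split_ifs with h
    · exact h.1 k le_rfl hk
    · exact zero_le_one
  · unfold truncNNinfty at h h'
    split_ifs at h h' with hz hz'
    rcases le_total k k' with hle | hle
    · exact hz'.2 k hle k' le_rfl hk hk' h h'
    · exact hz.2 k le_rfl k' hle hk hk' h h'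

lemma truncNNinfty_of_mem {z : ℕ → ℕ} (hz : z ∈ NNinfty) : truncNNinfty z = z :=
  funext fun n => if_pos (mem_NNinfty_iff_forall_upTo.1 hz n)

open Classical in
lemma truncNNinfty_congr {z w : ℕ → ℕ} {n : ℕ} (h : ∀ k ≤ n, z k = w k) :
    truncNNinfty z n = truncNNinfty w n := by
  have hiff : NNinftyUpTo z n ↔ NNinftyUpTo w n :=
    ⟨.congr h, .congr fun k hk => (h k hk).symm⟩
  unfold truncNNinfty
  rw [h n le_rfl]
  exact if_congr hiff rfl rfl

open Classical in
/-- Follow `f` on the truncation of `z` as long as `z` looks like an element of `NNinfty`, and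
afterwards output codes, which are at least `2`, of the initial segments of `z`. -/
noncomputable def extendNNinfty (f : NNinfty → NNinfty) (z : ℕ → ℕ) (n : ℕ) : ℕ :=
  if NNinftyUpTo z n then (f ⟨truncNNinfty z, truncNNinfty_mem z⟩ : ℕ → ℕ) n
  else Encodable.encode ((List.range (n + 1)).map z) + 2

lemma extendNNinfty_of_mem (f : NNinfty → NNinfty) (x : NNinfty) :
    extendNNinfty f x = f x := by
  funext n
  rw [extendNNinfty, if_pos (mem_NNinfty_iff_forall_upTo.1 x.2 n)]
  rw [show (⟨truncNNinfty x, truncNNinfty_mem x⟩ : NNinfty) = x from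
    Subtype.ext (truncNNinfty_of_mem x.2)]

lemma extendNNinfty_le_one_iff (f : NNinfty → NNinfty) (z : ℕ → ℕ) {n : ℕ} (hn : 1 ≤ n) :
    extendNNinfty f z n ≤ 1 ↔ NNinftyUpTo z n := by
  unfold extendNNinfty
  split_ifs with h
  · exact iff_of_true ((f _).2.1 n hn) h
  · exact iff_of_false (by omega) h

lemma extendNNinfty_mem_iff (f : NNinfty → NNinfty) (z : ℕ → ℕ) :
    extendNNinfty f z ∈ NNinfty ↔ z ∈ NNinfty := by
  refine ⟨fun h => mem_NNinfty_iff_forall_upTo.2 fun n => ?_, fun h => ?_⟩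
  · rcases Nat.eq_zero_or_pos n with rfl | hn
    · exact .zero z
    · exact (extendNNinfty_le_one_iff f z hn).1 (h.1 n hn)
  · rw [extendNNinfty_of_mem f ⟨z, h⟩]
    exact (f _).2

lemma extendNNinfty_injective {f : NNinfty → NNinfty} (hf : Function.Injective f) :
    Function.Injective (extendNNinfty f) := by
  intro z w h
  by_cases hz : z ∈ NNinfty
  · have hw : w ∈ NNinfty := by rwa [← extendNNinfty_mem_iff f, ← h, extendNNinfty_mem_iff]
    rw [extendNNinfty_of_mem f ⟨z, hz⟩, extendNNinfty_of_mem f ⟨w, hw⟩] at h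
    exact congrArg Subtype.val (hf (Subtype.ext h))
  · obtain ⟨m, hm⟩ := not_forall.1 (mt mem_NNinfty_iff_forall_upTo.2 hz)
    have hm0 : 1 ≤ m := Nat.one_le_iff_ne_zero.2 fun h0 => hm (h0 ▸ .zero z)
    funext k
    have hzn : ¬ NNinftyUpTo z (max m k) := mt (.mono (le_max_left m k)) hm
    have hwn : ¬ NNinftyUpTo w (max m k) := by
      rwa [← extendNNinfty_le_one_iff f w (hm0.trans (le_max_left m k)), ← h,
        extendNNinfty_le_one_iff f z (hm0.trans (le_max_left m k))]
    have hcode := congrFun h (max m k)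
    rw [extendNNinfty, extendNNinfty, if_neg hzn, if_neg hwn, Nat.add_right_cancel_iff,
      Encodable.encode_inj, List.map_inj_left] at hcode
    exact hcode k (List.mem_range.2 (Nat.lt_succ_of_le (le_max_right m k)))

open Classical in
lemma continuous_extendNNinfty {f : NNinfty → NNinfty} {μ : ℕ → ℕ → ℕ}
    (hμ : ∀ (x y : NNinfty) (n : ℕ),
      (∀ k : ℕ, k < μ ((x : ℕ → ℕ) 0) n → (x : ℕ → ℕ) k = (y : ℕ → ℕ) k) →
      (f x : ℕ → ℕ) n = (f y : ℕ → ℕ) n) :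
    Continuous (extendNNinfty f) := by
  refine continuous_pi fun n => continuous_iff_continuousAt.2 fun z => ?_
  have hagree : ∀ᶠ w in nhds z, ∀ k ∈ Set.Iic (max n (μ (truncNNinfty z 0) n)), z k = w k :=
    (Set.finite_Iic _).eventually_all.2 fun k _ =>
      ((continuous_apply k).tendsto z).eventually (by simp [nhds_discrete])
  refine tendsto_const_nhds.congr' (hagree.mono fun w hw => ?_)
  have hn : ∀ k ≤ n, z k = w k := fun k hk => hw k (hk.trans (le_max_left _ _))
  have hiff : NNinftyUpTo z n ↔ NNinftyUpTo w n :=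
    ⟨.congr hn, .congr fun k hk => (hn k hk).symm⟩
  have hmap : (List.range (n + 1)).map z = (List.range (n + 1)).map w :=
    List.map_congr_left fun k hk => hn k (Nat.le_of_lt_succ (List.mem_range.1 hk))
  have hfn := hμ ⟨truncNNinfty z, truncNNinfty_mem z⟩ ⟨truncNNinfty w, truncNNinfty_mem w⟩ n
    fun k hk => truncNNinfty_congr fun i hi =>
      hw i ((hi.trans hk.le).trans (le_max_right _ _))
  beta_reduce
  rw [extendNNinfty, extendNNinfty, hfn, hmap]
  exact if_congr hiff rfl rfl

/-- Extension lemma for Baire space: an injection of `NNinfty` with a modulus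
of continuity extends to a continuous injection of Baire space preserving
`NNinfty` by preimage. -/
theorem baire_extension (f : NNinfty → NNinfty) (hf : Function.Injective f)
    (μ : ℕ → ℕ → ℕ)
    (hμ : ∀ (x y : NNinfty) (n : ℕ),
      (∀ k : ℕ, k < μ ((x : ℕ → ℕ) 0) n → (x : ℕ → ℕ) k = (y : ℕ → ℕ) k) →
      (f x : ℕ → ℕ) n = (f y : ℕ → ℕ) n) :
    ∃ F : (ℕ → ℕ) → (ℕ → ℕ), Continuous F ∧ Function.Injective F ∧
      (∀ x : NNinfty, F (x : ℕ → ℕ) = (f x : ℕ → ℕ)) ∧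
      F ⁻¹' NNinfty = NNinfty := by
  exact ⟨extendNNinfty f, continuous_extendNNinfty hμ, extendNNinfty_injective hf,
    extendNNinfty_of_mem f, Set.ext (extendNNinfty_mem_iff f)⟩
end

section
/- Extension lemma for Cantor space: define e : ℕ∞ → (ℕ → Bool) by e p n = decide (p = ↑n), and the interleaving embedding j : ℕ∞ × ℕ∞ → (ℕ → Bool) by j (p, q) (2n) = e p n and j (p, q) (2n+1) = e q n. For every continuous injective function f : ℕ∞ × ℕ∞ → ℕ∞ × ℕ∞, there exists a continuous injective function F : (ℕ → Bool) → (ℕ → Bool) such that F ∘ j = j ∘ f and F ⁻¹' (Set.range j) = Set.range j. -/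
/-- `e p` is the binary sequence with a `1` exactly at position `p`
(the zero sequence if `p = ⊤`). -/
def eSeq (p : ℕ∞) (n : ℕ) : Bool := decide (p = (n : ℕ∞))

/-- The interleaving embedding of `ℕ∞ × ℕ∞` into Cantor space:
`j (p, q) (2n) = e p n` and `j (p, q) (2n+1) = e q n`. -/
def jEmb (pq : ℕ∞ × ℕ∞) (n : ℕ) : Bool :=
  if n % 2 = 0 then eSeq pq.1 (n / 2) else eSeq pq.2 (n / 2)

open Topology Filter

/-- A map into sequences whose `n`-th coordinate only depends on the first coordinates, up to `n`,
of a continuous map into sequences over a discrete space is continuous. -/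
theorem continuous_of_initial_segments {X β γ : Type*} [TopologicalSpace X]
    [TopologicalSpace β] [DiscreteTopology β] [TopologicalSpace γ]
    {φ : X → ℕ → β} (hφ : Continuous φ) {ψ : X → ℕ → γ}
    (h : ∀ x y n, (∀ i ≤ n, φ x i = φ y i) → ψ x n = ψ y n) : Continuous ψ := by
  refine continuous_pi fun n => continuous_iff_continuousAt.2 fun x => ?_
  have hev : ∀ᶠ y in 𝓝 x, ∀ i ∈ Set.Iic n, φ x i = φ y i := by
    refine (eventually_all_finite (Set.finite_Iic n)).2 fun i _ => ?_
    have hi : Continuous fun y => φ y i := (continuous_apply i).comp hφ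
    have := hi.tendsto x (show {φ x i} ∈ 𝓝 (φ x i) by simp)
    filter_upwards [this] with y hy
    exact (Set.mem_singleton_iff.1 hy).symm
  refine continuousAt_const.congr (f := fun _ => ψ x n) ?_
  filter_upwards [hev] with y hy
  exact h x y n hy

theorem continuous_eSeq : Continuous eSeq := by
  refine continuous_pi fun n => ?_
  have hc : IsClopen {p : ℕ∞ | p = (n : ℕ∞)} :=
    ⟨isClosed_singleton, ENat.isOpen_singleton (ENat.natCast_ne_top n)⟩
  refine (continuous_bool_rng true).2 ?_
  convert hc using 1
  ext p
  simp [eSeq]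

theorem eSeq_injective : Function.Injective eSeq := by
  have key : ∀ p q : ℕ∞, eSeq p = eSeq q → ∀ n : ℕ, p = n → p = q := by
    intro p q h n hp
    have := congrFun h n
    simp only [eSeq, hp, decide_true] at this
    rw [hp, of_decide_eq_true this.symm]
  intro p q h
  induction p using ENat.recTopCoe with
  | coe n => exact key _ _ h n rfl
  | top =>
    induction q using ENat.recTopCoe with
    | coe n => exact (key _ _ h.symm n rfl).symm
    | top => rfl

theorem jEmb_two_mul (p : ℕ∞ × ℕ∞) (n : ℕ) : jEmb p (2 * n) = eSeq p.1 n := by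
  simp [jEmb]

theorem jEmb_two_mul_add_one (p : ℕ∞ × ℕ∞) (n : ℕ) :
    jEmb p (2 * n + 1) = eSeq p.2 n := by
  have h1 : (2 * n + 1) % 2 = 1 := by omega
  have h2 : (2 * n + 1) / 2 = n := by omega
  simp [jEmb, h1, h2]

theorem jEmb_injective : Function.Injective jEmb := by
  intro p q h
  refine Prod.ext (eSeq_injective (funext fun n => ?_)) (eSeq_injective (funext fun n => ?_))
  · rw [← jEmb_two_mul, ← jEmb_two_mul, h]
  · rw [← jEmb_two_mul_add_one, ← jEmb_two_mul_add_one, h]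

theorem continuous_jEmb : Continuous jEmb := by
  refine continuous_pi fun n => ?_
  unfold jEmb
  split_ifs
  · exact (continuous_apply _).comp (continuous_eSeq.comp continuous_fst)
  · exact (continuous_apply _).comp (continuous_eSeq.comp continuous_snd)

open Classical in
/-- The position of the first `1` of a binary sequence, `⊤` if there is none. -/
noncomputable def firstOne (c : ℕ → Bool) : ℕ∞ :=
  if h : ∃ n, c n = true then (Nat.find h : ℕ∞) else ⊤

theorem firstOne_eq_coe_iff (c : ℕ → Bool) (n : ℕ) :
    firstOne c = n ↔ c n = true ∧ ∀ i < n, c i = false := by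
  classical
  unfold firstOne
  split_ifs with h
  · rw [Nat.cast_inj, Nat.find_eq_iff]
    simp
  · push Not at h
    simp [h n]

theorem firstOne_eq_top_iff (c : ℕ → Bool) : firstOne c = ⊤ ↔ ∀ n, c n = false := by
  unfold firstOne
  split_ifs with h <;> simpa using h

theorem firstOne_eSeq (p : ℕ∞) : firstOne (eSeq p) = p := by
  induction p using ENat.recTopCoe with
  | coe n =>
    rw [firstOne_eq_coe_iff]
    refine ⟨by simp [eSeq], fun i hi => ?_⟩
    simp [eSeq, hi.ne']
  | top =>
    rw [firstOne_eq_top_iff]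
    simp [eSeq]

theorem continuous_firstOne : Continuous firstOne := by
  refine (continuous_eSeq.isClosedEmbedding eSeq_injective).isInducing.continuous_iff.2 ?_
  refine continuous_of_initial_segments continuous_id fun x y n h => ?_
  simp only [Function.comp_apply, eSeq, firstOne_eq_coe_iff, decide_eq_decide]
  simp only [id] at h
  rw [h n le_rfl]
  refine and_congr_right fun _ => forall₂_congr fun i hi => ?_
  rw [h i hi.le]

/-- A continuous left inverse of `jEmb`. -/
noncomputable def jRetract (x : ℕ → Bool) : ℕ∞ × ℕ∞ :=
  (firstOne fun n => x (2 * n), firstOne fun n => x (2 * n + 1))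

theorem continuous_jRetract : Continuous jRetract :=
  (continuous_firstOne.comp (continuous_pi fun _ => continuous_apply _)).prodMk
    (continuous_firstOne.comp (continuous_pi fun _ => continuous_apply _))

theorem jRetract_jEmb (p : ℕ∞ × ℕ∞) : jRetract (jEmb p) = p := by
  simp only [jRetract, jEmb_two_mul, jEmb_two_mul_add_one]
  exact Prod.ext (firstOne_eSeq _) (firstOne_eSeq _)

/-- Marks the positions where a sequence differs from its retraction to the range of `jEmb`. -/
noncomputable def mismatch (x : ℕ → Bool) (n : ℕ) : Bool := xor (x n) (jEmb (jRetract x) n)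

theorem continuous_mismatch : Continuous mismatch := by
  refine continuous_pi fun n => ?_
  have h : Continuous fun b : Bool × Bool => xor b.1 b.2 := continuous_of_discreteTopology
  exact h.comp ((continuous_apply n).prodMk
    ((continuous_apply n).comp (continuous_jEmb.comp continuous_jRetract)))

theorem firstOne_mismatch_eq_top_iff (x : ℕ → Bool) :
    firstOne (mismatch x) = ⊤ ↔ x ∈ Set.range jEmb := by
  rw [firstOne_eq_top_iff]
  constructor
  · intro h
    refine ⟨jRetract x, funext fun n => ?_⟩
    have hn : x n = jEmb (jRetract x) n := by simpa [mismatch] using h n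
    exact hn.symm
  · rintro ⟨p, rfl⟩ n
    simp [mismatch, jRetract_jEmb]

/-- The first `2 * m` entries of `h`, followed by `111100`, followed by `x`. -/
def splice (m : ℕ) (h x : ℕ → Bool) (n : ℕ) : Bool :=
  if n / 2 < m then h n else if n / 2 < m + 2 then true else
    if n / 2 < m + 3 then false else x (n - 2 * (m + 3))

theorem splice_two_mul_of_lt {m k : ℕ} (hk : k < m) (h x : ℕ → Bool) :
    splice m h x (2 * k) = h (2 * k) := by
  simp [splice, hk]

theorem splice_marker (m : ℕ) (h x : ℕ → Bool) :
    splice m h x (2 * m) = true ∧ splice m h x (2 * (m + 1)) = true ∧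
      splice m h x (2 * (m + 2)) = false := by
  simp [splice]

theorem splice_tail (m : ℕ) (h x : ℕ → Bool) (n : ℕ) :
    splice m h x (n + 2 * (m + 3)) = x n := by
  have h1 : ¬ (n + 2 * (m + 3)) / 2 < m := by omega
  have h2 : ¬ (n + 2 * (m + 3)) / 2 < m + 2 := by omega
  have h3 : ¬ (n + 2 * (m + 3)) / 2 < m + 3 := by omega
  simp [splice, h1, h2, h3]

theorem eq_of_jEmb_two_mul {p : ℕ∞ × ℕ∞} {k l : ℕ} (hk : jEmb p (2 * k) = true)
    (hl : jEmb p (2 * l) = true) : k = l := by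
  rw [jEmb_two_mul] at hk hl
  have := (of_decide_eq_true hk).symm.trans (of_decide_eq_true hl)
  exact_mod_cast this

theorem splice_ne_jEmb (m : ℕ) (h x : ℕ → Bool) (p : ℕ∞ × ℕ∞) : splice m h x ≠ jEmb p := by
  intro heq
  obtain ⟨h0, h1, -⟩ := splice_marker m h x
  rw [heq] at h0 h1
  have := eq_of_jEmb_two_mul h0 h1
  omega

theorem le_of_splice_eq {m m' : ℕ} {h x x' : ℕ → Bool} {p : ℕ∞ × ℕ∞}
    (heq : splice m h x = splice m' (jEmb p) x') : m' ≤ m := by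
  by_contra! hlt
  obtain ⟨h0, h1, h2⟩ := splice_marker m h x
  rw [heq] at h0 h1 h2
  rcases Nat.lt_or_ge (m + 1) m' with hm | hm
  · rw [splice_two_mul_of_lt (by omega)] at h0 h1
    have := eq_of_jEmb_two_mul h0 h1
    omega
  · obtain rfl : m' = m + 1 := by omega
    rw [(splice_marker (m + 1) (jEmb p) x').2.1] at h2
    exact absurd h2 (by simp)

theorem splice_injective {m m' : ℕ} {p p' : ℕ∞ × ℕ∞} {x x' : ℕ → Bool}
    (heq : splice m (jEmb p) x = splice m' (jEmb p') x') : x = x' := by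
  obtain rfl : m = m' := le_antisymm (le_of_splice_eq heq.symm) (le_of_splice_eq heq)
  funext n
  rw [← splice_tail m (jEmb p) x n, heq, splice_tail]

/-- Splices `x` into `h` at position `m`; this is `h` itself if `m = ⊤`. -/
def spliceAt : ℕ∞ → (ℕ → Bool) → (ℕ → Bool) → ℕ → Bool
  | ⊤, h, _ => h
  | (m : ℕ), h, x => splice m h x

theorem spliceAt_eq_of_lt {p : ℕ∞} {n : ℕ} (hp : (n : ℕ∞) < p) (h x : ℕ → Bool) :
    spliceAt p h x n = h n := by
  induction p using ENat.recTopCoe with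
  | top => rfl
  | coe m =>
    have hm : n < m := by exact_mod_cast hp
    have : n / 2 < m := by omega
    change splice m h x n = h n
    simp [splice, this]

theorem splice_congr {m n : ℕ} {h h' x x' : ℕ → Bool} (hh : ∀ i ≤ n, h i = h' i)
    (hx : ∀ i ≤ n, x i = x' i) : splice m h x n = splice m h' x' n := by
  simp only [splice, hh n le_rfl, hx _ (Nat.sub_le _ _)]

theorem firstOne_congr {c c' : ℕ → Bool} {n : ℕ} (hc : ∀ i ≤ n, c i = c' i) {m : ℕ}
    (hm : m ≤ n) : firstOne c = m ↔ firstOne c' = m := by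
  rw [firstOne_eq_coe_iff, firstOne_eq_coe_iff, hc m hm]
  refine and_congr_right fun _ => forall₂_congr fun i hi => ?_
  rw [hc i (by omega)]

theorem spliceAt_firstOne_congr {n : ℕ} {c c' h h' x x' : ℕ → Bool}
    (hc : ∀ i ≤ n, c i = c' i) (hh : ∀ i ≤ n, h i = h' i) (hx : ∀ i ≤ n, x i = x' i) :
    spliceAt (firstOne c) h x n = spliceAt (firstOne c') h' x' n := by
  by_cases hle : ∃ m ≤ n, firstOne c = (m : ℕ∞)
  · obtain ⟨m, hm, hcm⟩ := hle
    rw [hcm, (firstOne_congr hc hm).1 hcm]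
    exact splice_congr hh hx
  · have hlt : ∀ p : ℕ∞, (¬ ∃ m ≤ n, p = (m : ℕ∞)) → (n : ℕ∞) < p := by
      intro p hp
      by_contra! hpn
      lift p to ℕ using ne_top_of_le_ne_top (ENat.natCast_ne_top n) hpn
      exact hp ⟨p, by exact_mod_cast hpn, rfl⟩
    have hle' : ¬ ∃ m ≤ n, firstOne c' = (m : ℕ∞) := fun ⟨m, hm, hcm⟩ =>
      hle ⟨m, hm, (firstOne_congr hc hm).2 hcm⟩
    rw [spliceAt_eq_of_lt (hlt _ hle), spliceAt_eq_of_lt (hlt _ hle'), hh n le_rfl]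

/-- Extension lemma for Cantor space: every continuous injection of `ℕ∞ × ℕ∞`
extends along `j` to a continuous injection of Cantor space preserving the
range of `j` by preimage. -/
theorem cantor_extension (f : ℕ∞ × ℕ∞ → ℕ∞ × ℕ∞)
    (hfc : Continuous f) (hf : Function.Injective f) :
    ∃ F : (ℕ → Bool) → (ℕ → Bool), Continuous F ∧ Function.Injective F ∧
      F ∘ jEmb = jEmb ∘ f ∧ F ⁻¹' (Set.range jEmb) = Set.range jEmb := by
  let h : (ℕ → Bool) → ℕ → Bool := fun x => jEmb (f (jRetract x))
  have hh : Continuous h := continuous_jEmb.comp (hfc.comp continuous_jRetract)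
  let F : (ℕ → Bool) → ℕ → Bool := fun x => spliceAt (firstOne (mismatch x)) (h x) x
  have hF_range : ∀ p, F (jEmb p) = jEmb (f p) := by
    intro p
    simp only [F, (firstOne_mismatch_eq_top_iff _).2 (Set.mem_range_self p)]
    change jEmb (f (jRetract (jEmb p))) = _
    rw [jRetract_jEmb]
  have hF_compl : ∀ x ∉ Set.range jEmb, ∃ m, F x = splice m (h x) x := by
    intro x hx
    rw [← firstOne_mismatch_eq_top_iff] at hx
    obtain ⟨m, hm⟩ := ENat.ne_top_iff_exists.1 hx
    exact ⟨m, by simp only [F, ← hm]; rfl⟩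
  have hF_mem : ∀ x, F x ∈ Set.range jEmb → x ∈ Set.range jEmb := by
    rintro x ⟨p, hp⟩
    by_contra hx
    obtain ⟨m, hm⟩ := hF_compl x hx
    exact splice_ne_jEmb m (h x) x p (hm.symm.trans hp.symm)
  have hF_maps : ∀ x ∈ Set.range jEmb, F x ∈ Set.range jEmb := by
    rintro _ ⟨p, rfl⟩
    exact ⟨f p, (hF_range p).symm⟩
  refine ⟨F, ?_, ?_, funext hF_range, Set.Subset.antisymm hF_mem hF_maps⟩
  · have hφ : Continuous fun x n => (mismatch x n, h x n, x n) :=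
      continuous_pi fun n => ((continuous_apply n).comp continuous_mismatch).prodMk
        (((continuous_apply n).comp hh).prodMk (continuous_apply n))
    refine continuous_of_initial_segments hφ fun x y n hxy => ?_
    simp only [Prod.mk.injEq] at hxy
    exact spliceAt_firstOne_congr (fun i hi => (hxy i hi).1) (fun i hi => (hxy i hi).2.1)
      fun i hi => (hxy i hi).2.2
  · intro x y hxy
    by_cases hx : x ∈ Set.range jEmb
    · obtain ⟨q, rfl⟩ := hF_mem y (hxy ▸ hF_maps x hx)
      obtain ⟨p, rfl⟩ := hx
      rw [hF_range, hF_range] at hxy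
      rw [hf (jEmb_injective hxy)]
    · have hy : y ∉ Set.range jEmb := fun hy => hx (hF_mem x (hxy ▸ hF_maps y hy))
      obtain ⟨m, hm⟩ := hF_compl x hx
      obtain ⟨m', hm'⟩ := hF_compl y hy
      exact splice_injective (hm.symm.trans (hxy.trans hm'))
end
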